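/- arXiv:2101.03441 — 3 statements merged into one kernel-verified Lean document; each statement's English description precedes it below -/
import Mathlib

section
/- For every finite index set ι and every z : ι → ℝ with 0 ≤ z i ≤ 1 for all i ∈ ι, one has (1 − 1/e) · min(1, Σ_{i ∈ ι} z i) ≤ 1 − Π_{i ∈ ι} (1 − z i) ≤ min(1, Σ_{i ∈ ι} z i), where e = exp 1. (Goemans–Williamson inequality, Lemma 5.) -/
open Finset

/-- The chord of `exp (-x)` over `[0, 1]` lies above its graph. -/
lemma exp_neg_le_chord {t : ℝ} (ht₀ : 0 ≤ t) (ht₁ : t ≤ 1) :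
    Real.exp (-t) ≤ 1 - (1 - 1 / Real.exp 1) * t := by
  have h := convexOn_exp.2 (Set.mem_univ 0) (Set.mem_univ (-1)) (sub_nonneg.2 ht₁) ht₀
    (sub_add_cancel 1 t)
  simp only [smul_eq_mul, mul_zero, zero_add, mul_neg, mul_one, Real.exp_zero, Real.exp_neg] at h
  rw [Real.exp_neg, one_div]
  linarith

/-- The Weierstrass product inequality. -/
lemma one_sub_sum_le_prod_one_sub {ι : Type*} (s : Finset ι) (z : ι → ℝ)
    (hz : ∀ i ∈ s, 0 ≤ z i ∧ z i ≤ 1) : 1 - ∑ i ∈ s, z i ≤ ∏ i ∈ s, (1 - z i) := by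
  classical
  induction s using Finset.induction_on with
  | empty => simp
  | insert a s ha ih =>
    have hs : ∀ i ∈ s, 0 ≤ z i ∧ z i ≤ 1 := fun i hi => hz i (Finset.mem_insert_of_mem hi)
    have hprod : ∏ i ∈ s, (1 - z i) ≤ 1 :=
      Finset.prod_le_one (fun i hi => sub_nonneg.2 (hs i hi).2)
        (fun i hi => sub_le_self 1 (hs i hi).1)
    rw [Finset.sum_insert ha, Finset.prod_insert ha]
    linarith [ih hs, mul_le_of_le_one_right (hz a (Finset.mem_insert_self a s)).1 hprod]

/-- Goemans–Williamson inequality (Lemma 5): for `0 ≤ z i ≤ 1`,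
`(1 − 1/e) · min(1, Σ z i) ≤ 1 − Π (1 − z i) ≤ min(1, Σ z i)`. -/
theorem stmt_2 {ι : Type*} [Fintype ι] (z : ι → ℝ) (hz : ∀ i, 0 ≤ z i ∧ z i ≤ 1) :
    (1 - 1 / Real.exp 1) * min 1 (∑ i, z i) ≤ 1 - ∏ i, (1 - z i) ∧
      1 - ∏ i, (1 - z i) ≤ min 1 (∑ i, z i) := by
  constructor
  · have hprod : ∏ i, (1 - z i) ≤ Real.exp (-∑ i, z i) := by
      rw [← Finset.sum_neg_distrib, Real.exp_sum]
      exact Finset.prod_le_prod (fun i _ => sub_nonneg.2 (hz i).2)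
        (fun i _ => Real.one_sub_le_exp_neg (z i))
    have hmin : Real.exp (-∑ i, z i) ≤ Real.exp (-min 1 (∑ i, z i)) :=
      Real.exp_le_exp.2 (neg_le_neg (min_le_right _ _))
    have hchord := exp_neg_le_chord
      (le_min zero_le_one (Finset.sum_nonneg fun i _ => (hz i).1)) (min_le_left 1 (∑ i, z i))
    linarith
  · refine le_min (sub_le_self 1 (Finset.prod_nonneg fun i _ => sub_nonneg.2 (hz i).2)) ?_
    linarith [one_sub_sum_le_prod_one_sub Finset.univ z fun i _ => hz i]
end

section
/- Let f : (ι → ℝ) → ℝ be differentiable and DR-submodular on the box X. Then for all a, b ∈ X, Σ_{i ∈ ι} (b i − a i) · (∂f/∂x_i)(a) ≥ f(a ⊔ b) + f(a ⊓ b) − 2·f(a), where ∂f/∂x_i denotes the partial derivative of f in the i-th coordinate. (First-order inequality for differentiable DR-submodular functions, used in the proof of Lemma 3.) -/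
open Finset

/-- Diminishing returns along coordinate directions on an order interval imply diminishing returns
along every nonnegative direction. -/
theorem sub_le_sub_of_coord_diminishing {ι : Type*} [Fintype ι] [DecidableEq ι]
    {lo hi : ι → ℝ} {f : (ι → ℝ) → ℝ}
    (hDR : ∀ a ∈ Set.Icc lo hi, ∀ b ∈ Set.Icc lo hi, (∀ i, a i ≤ b i) → ∀ i₀ : ι, ∀ k : ℝ, 0 ≤ k →
      a + k • (Pi.single i₀ 1 : ι → ℝ) ∈ Set.Icc lo hi →
      b + k • (Pi.single i₀ 1 : ι → ℝ) ∈ Set.Icc lo hi →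
      f (a + k • (Pi.single i₀ 1 : ι → ℝ)) - f a ≥
        f (b + k • (Pi.single i₀ 1 : ι → ℝ)) - f b)
    {x y v : ι → ℝ} (hv : 0 ≤ v) (hxy : x ≤ y) (hx : lo ≤ x) (hyv : y + v ≤ hi) :
    f (y + v) - f y ≤ f (x + v) - f x := by
  have hle : ∀ s : Finset ι, ∑ i ∈ s, v i • (Pi.single i 1 : ι → ℝ) ≤ v := by
    intro s j
    have hj := hv j
    simp only [Finset.sum_apply, Pi.smul_apply, Pi.single_apply, smul_eq_mul, mul_ite, mul_one,
      mul_zero, Finset.sum_ite_eq]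
    split_ifs
    · exact le_rfl
    · exact hj
  have hnonneg : ∀ s : Finset ι, 0 ≤ ∑ i ∈ s, v i • (Pi.single i 1 : ι → ℝ) := fun s =>
    Finset.sum_nonneg fun i _ => smul_nonneg (hv i) (Pi.single_nonneg.2 zero_le_one)
  have hmem : ∀ z, x ≤ z → z ≤ y → ∀ s : Finset ι,
      z + ∑ i ∈ s, v i • (Pi.single i 1 : ι → ℝ) ∈ Set.Icc lo hi := fun z hxz hzy s =>
    ⟨(hx.trans hxz).trans (le_add_of_nonneg_right (hnonneg s)),
      (add_le_add hzy (hle s)).trans hyv⟩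
  have key : ∀ s : Finset ι,
      f (y + ∑ i ∈ s, v i • (Pi.single i 1 : ι → ℝ)) - f y ≤
        f (x + ∑ i ∈ s, v i • (Pi.single i 1 : ι → ℝ)) - f x := by
    intro s
    induction s using Finset.induction_on with
    | empty => simp
    | insert j s hj ih =>
      have hsplit : ∀ z : ι → ℝ, z + ∑ i ∈ insert j s, v i • (Pi.single i 1 : ι → ℝ) =
          z + ∑ i ∈ s, v i • (Pi.single i 1 : ι → ℝ) + v j • (Pi.single j 1 : ι → ℝ) := by
        intro z
        rw [Finset.sum_insert hj, add_comm (v j • _), add_assoc]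
      have h := hDR _ (hmem x le_rfl hxy s) _ (hmem y hxy le_rfl s)
        (fun i => add_le_add_left hxy _ i) j (v j) (hv j)
        (by rw [← hsplit]; exact hmem x le_rfl hxy _)
        (by rw [← hsplit]; exact hmem y hxy le_rfl _)
      rw [hsplit, hsplit]
      linarith
  have hsum : ∑ i, v i • (Pi.single i 1 : ι → ℝ) = v := by
    ext j
    simp [Finset.sum_apply, Pi.single_apply]
  simpa only [hsum] using key Finset.univ

/-- If, among the equal steps subdividing a segment, the first one has the largest increment,
then the increment over the segment is at most the directional derivative at its start. -/
theorem sub_le_fderiv_of_step_le {E : Type*} [NormedAddCommGroup E] [NormedSpace ℝ E]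
    {f : E → ℝ} {a w : E} (hf : DifferentiableAt ℝ f a)
    (hstep : ∀ n k : ℕ, k < n →
      f (a + ((k + 1 : ℝ) / n) • w) - f (a + ((k : ℝ) / n) • w) ≤ f (a + (n : ℝ)⁻¹ • w) - f a) :
    f (a + w) - f a ≤ fderiv ℝ f a w := by
  have hlim := hf.hasFDerivAt.lim w (c := fun n : ℕ => (n : ℝ)) (l := Filter.atTop)
    (by simpa using tendsto_natCast_atTop_atTop (R := ℝ))
  refine ge_of_tendsto hlim ?_
  filter_upwards [Filter.eventually_gt_atTop 0] with n hn
  have hsum := Finset.sum_le_sum fun k hk => hstep n k (Finset.mem_range.1 hk)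
  have htel := Finset.sum_range_sub (fun k : ℕ => f (a + ((k : ℝ) / n) • w)) n
  have hn' : (n : ℝ) ≠ 0 := by positivity
  simp only [Nat.cast_add, Nat.cast_one, Nat.cast_zero, zero_div, zero_smul, add_zero,
    div_self hn', one_smul] at htel
  rw [htel] at hsum
  simpa [mul_sub] using hsum

/-- First-order inequality for differentiable DR-submodular functions (used in Lemma 3):
if `f` is differentiable and DR-submodular on the box `X`, then for `a, b ∈ X`,
`Σ_i (b i − a i) · (∂f/∂x_i)(a) ≥ f(a ⊔ b) + f(a ⊓ b) − 2·f(a)`. -/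
theorem stmt_5 {ι : Type*} [Fintype ι] [DecidableEq ι]
    (lo hi : ι → ℝ) (hlohi : ∀ i, lo i ≤ hi i)
    (X : Set (ι → ℝ)) (hX : X = {x : ι → ℝ | ∀ i, lo i ≤ x i ∧ x i ≤ hi i})
    (f : (ι → ℝ) → ℝ)
    (hdiff : ∀ x ∈ X, DifferentiableAt ℝ f x)
    (hDR : ∀ a ∈ X, ∀ b ∈ X, (∀ i, a i ≤ b i) → ∀ i₀ : ι, ∀ k : ℝ, 0 ≤ k →
      a + k • (Pi.single i₀ 1 : ι → ℝ) ∈ X → b + k • (Pi.single i₀ 1 : ι → ℝ) ∈ X →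
      f (a + k • (Pi.single i₀ 1 : ι → ℝ)) - f a ≥
        f (b + k • (Pi.single i₀ 1 : ι → ℝ)) - f b)
    (a : ι → ℝ) (ha : a ∈ X) (b : ι → ℝ) (hb : b ∈ X) :
    ∑ i, (b i - a i) * fderiv ℝ f a (Pi.single i 1) ≥ f (a ⊔ b) + f (a ⊓ b) - 2 * f a := by
  obtain rfl : X = Set.Icc lo hi := by
    rw [hX]
    ext x
    simp only [Set.mem_ofPred_eq, Set.mem_Icc, Pi.le_def, forall_and]
  have hinf : lo ≤ a ⊓ b := le_inf ha.1 hb.1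
  have hsup : a ⊔ b ≤ hi := sup_le ha.2 hb.2
  have hup : f (a + (a ⊔ b - a)) - f a ≤ fderiv ℝ f a (a ⊔ b - a) := by
    have hw : 0 ≤ a ⊔ b - a := sub_nonneg.2 le_sup_left
    refine sub_le_fderiv_of_step_le (hdiff a ha) fun n k hk => ?_
    have hn : (0 : ℝ) < n := by exact_mod_cast (Nat.zero_le k).trans_lt hk
    have hk1 : ((k : ℝ) + 1) / n ≤ 1 := (div_le_one hn).2 (by exact_mod_cast hk)
    have hadd : a + ((k + 1 : ℝ) / n) • (a ⊔ b - a) =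
        a + ((k : ℝ) / n) • (a ⊔ b - a) + (n : ℝ)⁻¹ • (a ⊔ b - a) := by
      module
    have hbound : a + ((k + 1 : ℝ) / n) • (a ⊔ b - a) ≤ hi := by
      calc a + ((k + 1 : ℝ) / n) • (a ⊔ b - a) ≤ a + (1 : ℝ) • (a ⊔ b - a) := by gcongr
        _ = a ⊔ b := by module
        _ ≤ hi := hsup
    rw [hadd] at hbound ⊢
    exact sub_le_sub_of_coord_diminishing hDR (smul_nonneg (by positivity) hw)
      (le_add_of_nonneg_right (smul_nonneg (by positivity) hw)) ha.1 hbound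
  have hdown : f (a + (a ⊓ b - a)) - f a ≤ fderiv ℝ f a (a ⊓ b - a) := by
    have hw : 0 ≤ a - a ⊓ b := sub_nonneg.2 inf_le_left
    refine sub_le_fderiv_of_step_le (hdiff a ha) fun n k hk => ?_
    have hn : (0 : ℝ) < n := by exact_mod_cast (Nat.zero_le k).trans_lt hk
    have hk1 : ((k : ℝ) + 1) / n ≤ 1 := (div_le_one hn).2 (by exact_mod_cast hk)
    have hneg : ∀ t : ℝ, a + t • (a ⊓ b - a) = a - t • (a - a ⊓ b) := fun t => by module
    have hx : lo ≤ a - ((k + 1 : ℝ) / n) • (a - a ⊓ b) := by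
      calc lo ≤ a ⊓ b := hinf
        _ = a - (1 : ℝ) • (a - a ⊓ b) := by module
        _ ≤ a - ((k + 1 : ℝ) / n) • (a - a ⊓ b) := by gcongr
    have hxy : a - ((k + 1 : ℝ) / n) • (a - a ⊓ b) ≤ a - (n : ℝ)⁻¹ • (a - a ⊓ b) := by
      have : (n : ℝ)⁻¹ ≤ (k + 1 : ℝ) / n := by
        rw [inv_eq_one_div]
        gcongr
        simp
      gcongr
    have h := sub_le_sub_of_coord_diminishing hDR (v := (n : ℝ)⁻¹ • (a - a ⊓ b))
      (smul_nonneg (by positivity) hw) hxy hx (by simpa using ha.2)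
    have hstep : a - ((k + 1 : ℝ) / n) • (a - a ⊓ b) + (n : ℝ)⁻¹ • (a - a ⊓ b) =
        a - ((k : ℝ) / n) • (a - a ⊓ b) := by
      module
    rw [hstep, sub_add_cancel] at h
    simp only [hneg]
    linarith
  have hgrad : ∑ i, (b i - a i) * fderiv ℝ f a (Pi.single i 1) = fderiv ℝ f a (b - a) := by
    conv_rhs => rw [pi_eq_sum_univ' (b - a), map_sum]
    refine Finset.sum_congr rfl fun i _ => ?_
    rw [map_smul, smul_eq_mul, Pi.sub_apply]
  have hsplit : b - a = (a ⊔ b - a) + (a ⊓ b - a) := by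
    linear_combination (exp := 1) -(inf_add_sup a b)
  rw [hgrad, hsplit, map_add]
  rw [add_sub_cancel] at hup hdown
  linarith
end

section
/- Let H be a symmetric real n × n matrix and J a real m × n matrix whose rows are linearly independent. Assume that for every nonzero x ∈ ℝⁿ with J·x = 0 one has xᵀ·H·x < 0 (H is negative definite on the kernel of J). Then the (n+m) × (n+m) block matrix [[H, Jᵀ], [J, 0]] is invertible. (Nonsingularity of the KKT matrix, proved in the appendix on second-order sufficiency for the Lagrangian barrier method.) -/
open Matrix

/-- Nonsingularity of the KKT matrix: if `H` is symmetric, the rows of `J` are linearly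
independent, and `H` is negative definite on the kernel of `J`, then the block matrix
`[[H, Jᵀ], [J, 0]]` is invertible. -/
theorem stmt_14 {n m : ℕ} (H : Matrix (Fin n) (Fin n) ℝ) (J : Matrix (Fin m) (Fin n) ℝ)
    (hH : H.IsSymm)
    (hJ : LinearIndependent ℝ (fun i : Fin m => J i))
    (hneg : ∀ x : Fin n → ℝ, x ≠ 0 → J.mulVec x = 0 → x ⬝ᵥ H.mulVec x < 0) :
    IsUnit (Matrix.fromBlocks H Jᵀ J (0 : Matrix (Fin m) (Fin m) ℝ)) := by
  rw [← mulVec_injective_iff_isUnit, ← coe_mulVecLin, injective_iff_map_eq_zero]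
  intro v hv
  rw [mulVecLin_apply, fromBlocks_mulVec, zero_mulVec, add_zero] at hv
  set x := v ∘ Sum.inl
  set y := v ∘ Sum.inr
  have h₁ : H *ᵥ x + Jᵀ *ᵥ y = 0 := funext fun i => congrFun hv (Sum.inl i)
  have h₂ : J *ᵥ x = 0 := funext fun i => congrFun hv (Sum.inr i)
  have hquad : x ⬝ᵥ H *ᵥ x = 0 := by
    have h := congrArg (x ⬝ᵥ ·) h₁
    simpa [dotProduct_add, dotProduct_mulVec x Jᵀ y, vecMul_transpose, h₂] using h
  have hx₀ : x = 0 := by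
    by_contra hne
    exact (hneg x hne h₂).ne hquad
  have hy₀ : y = 0 := by
    apply vecMul_injective_iff.mpr hJ
    simpa [hx₀, mulVec_transpose] using h₁
  funext i
  cases i with
  | inl i => exact congrFun hx₀ i
  | inr i => exact congrFun hy₀ i
end
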